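/- arXiv:1708.03256 — 5 statements merged into one kernel-verified Lean document; each statement's English description precedes it below -/
import Mathlib

section
/- A Borel measurable function α : [1,∞) → (0,∞) belongs to the class RO if and only if there exist Borel measurable bounded functions β, γ : [1,∞) → ℝ such that α(t) = exp( β(t) + ∫₁ᵗ (γ(τ)/τ) dτ ) for all t ≥ 1. -/
noncomputable section

/-- The class RO of Avakumović. -/
def RO (α : ℝ → ℝ) : Prop :=
  Measurable ((Set.Ici (1:ℝ)).restrict α) ∧ (∀ t, 1 ≤ t → 0 < α t) ∧
    ∃ b : ℝ, 1 < b ∧ ∃ c : ℝ, 1 ≤ c ∧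
      ∀ t, 1 ≤ t → ∀ l, 1 ≤ l → l ≤ b →
        c⁻¹ ≤ α (l * t) / α t ∧ α (l * t) / α t ≤ c

open MeasureTheory in
/-- A bounded Borel function on `[1,∞)` divided by the variable is integrable on compact
subintervals of `[1,∞)`. -/
theorem intervalIntegrable_div_of_bounded {γ : ℝ → ℝ} {M s t : ℝ}
    (hγ : Measurable ((Set.Ici (1:ℝ)).domRestrict γ)) (hM : ∀ t, 1 ≤ t → |γ t| ≤ M)
    (hs : 1 ≤ s) (ht : 1 ≤ t) :
    IntervalIntegrable (fun τ => γ τ / τ) volume s t := by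
  have hsub : Set.uIoc s t ⊆ Set.Ici (1:ℝ) := fun x hx => (le_min hs ht).trans hx.1.le
  rw [intervalIntegrable_iff]
  have hmeas : AEMeasurable (fun τ => γ τ / τ) (volume.restrict (Set.Ici (1:ℝ))) :=
    (aemeasurable_restrict_of_measurable_subtype measurableSet_Ici hγ).div aemeasurable_id
  refine IntegrableOn.of_bound (by simp [Set.uIoc])
    (hmeas.mono_measure (Measure.restrict_mono hsub le_rfl)).aestronglyMeasurable M ?_
  refine (ae_restrict_mem measurableSet_uIoc).mono fun x hx => ?_
  have hx1 : (1:ℝ) ≤ x := hsub hx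
  rw [Real.norm_eq_abs, abs_div, abs_of_pos (by linarith : 0 < x)]
  exact (div_le_self (abs_nonneg _) hx1).trans (hM x hx1)

/-- The index `n` of the geometric block `[b ^ n, b ^ (n + 1))` containing `t`. -/
def geomBlock (b t : ℝ) : ℕ := ⌊Real.log t / Real.log b⌋₊

theorem measurable_geomBlock (b : ℝ) : Measurable (geomBlock b) :=
  Nat.measurable_floor.comp (Real.measurable_log.div_const _)

theorem geomBlock_le {b t : ℝ} (hb : 1 < b) (ht : 1 ≤ t) : b ^ geomBlock b t ≤ t := by
  have hlb := Real.log_pos hb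
  rw [← Real.log_le_log_iff (by positivity) (by linarith), Real.log_pow, ← le_div_iff₀ hlb]
  exact Nat.floor_le (div_nonneg (Real.log_nonneg ht) hlb.le)

theorem lt_geomBlock_succ {b t : ℝ} (hb : 1 < b) (ht : 1 ≤ t) : t < b ^ (geomBlock b t + 1) := by
  have hlb := Real.log_pos hb
  rw [← Real.log_lt_log_iff (by linarith) (by positivity), Real.log_pow, ← div_lt_iff₀ hlb]
  exact_mod_cast Nat.lt_floor_add_one _

theorem geomBlock_eq {b t : ℝ} {n : ℕ} (hb : 1 < b) (h₁ : b ^ n ≤ t) (h₂ : t < b ^ (n + 1)) :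
    geomBlock b t = n := by
  have ht : 1 ≤ t := (one_le_pow₀ hb.le).trans h₁
  have h₃ := (pow_lt_pow_iff_right₀ hb).1 ((geomBlock_le hb ht).trans_lt h₂)
  have h₄ := (pow_lt_pow_iff_right₀ hb).1 (h₁.trans_lt (lt_geomBlock_succ hb ht))
  omega

/-- Integral over part of one block of a function that is constant on blocks. -/
theorem integral_geomBlock_div (g : ℕ → ℝ) {b t : ℝ} {n : ℕ} (hb : 1 < b) (h₁ : b ^ n ≤ t)
    (h₂ : t ≤ b ^ (n + 1)) :
    ∫ τ in (b ^ n)..t, g (geomBlock b τ) / τ = g n * (Real.log t - n * Real.log b) := by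
  have hbn : 0 < b ^ n := by positivity
  have hcongr : ∫ τ in (b ^ n)..t, g (geomBlock b τ) / τ = ∫ τ in (b ^ n)..t, g n * (1 / τ) := by
    rw [intervalIntegral.integral_of_le h₁, intervalIntegral.integral_of_le h₁,
      MeasureTheory.integral_Ioc_eq_integral_Ioo, MeasureTheory.integral_Ioc_eq_integral_Ioo]
    refine MeasureTheory.setIntegral_congr_fun measurableSet_Ioo fun τ hτ => ?_
    simp only [geomBlock_eq hb hτ.1.le (hτ.2.trans_le h₂)]
    ring
  rw [hcongr, intervalIntegral.integral_const_mul,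
    integral_one_div_of_pos hbn (hbn.trans_le h₁),
    Real.log_div (hbn.trans_le h₁).ne' hbn.ne', Real.log_pow]

/-- The logarithmic slopes of `f` between consecutive points of a geometric progression
integrate back to `f`. -/
theorem integral_logSlope (f : ℝ → ℝ) {b K : ℝ} (hb : 1 < b)
    (hK : ∀ n : ℕ, |(f (b ^ (n + 1)) - f (b ^ n)) / Real.log b| ≤ K) {n : ℕ} {t : ℝ}
    (h₁ : b ^ n ≤ t) (h₂ : t ≤ b ^ (n + 1)) :
    ∫ τ in (1:ℝ)..t,
        (f (b ^ (geomBlock b τ + 1)) - f (b ^ geomBlock b τ)) / Real.log b / τ =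
      f (b ^ n) - f 1 +
        (f (b ^ (n + 1)) - f (b ^ n)) / Real.log b * (Real.log t - n * Real.log b) := by
  set g : ℕ → ℝ := fun n => (f (b ^ (n + 1)) - f (b ^ n)) / Real.log b
  have hint : ∀ s t : ℝ, 1 ≤ s → 1 ≤ t →
      IntervalIntegrable (fun τ => g (geomBlock b τ) / τ) MeasureTheory.volume s t :=
    fun s t hs ht => intervalIntegrable_div_of_bounded (γ := fun τ => g (geomBlock b τ)) (M := K)
      (((measurable_from_nat (f := g)).comp (measurable_geomBlock b)).comp measurable_subtype_coe)
      (fun _ _ => hK _) hs ht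
  have hlb := Real.log_pos hb
  have key : ∀ n : ℕ, ∫ τ in (1:ℝ)..(b ^ n), g (geomBlock b τ) / τ = f (b ^ n) - f 1 := by
    intro n
    induction n with
    | zero => simp
    | succ n ih =>
      rw [← intervalIntegral.integral_add_adjacent_intervals
        (hint 1 (b ^ n) le_rfl (one_le_pow₀ hb.le))
        (hint (b ^ n) (b ^ (n + 1)) (one_le_pow₀ hb.le) (one_le_pow₀ hb.le)), ih,
        integral_geomBlock_div g hb (pow_le_pow_right₀ hb.le n.le_succ) le_rfl, Real.log_pow]
      simp only [g]
      field_simp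
      push_cast
      ring
  have hn : 1 ≤ b ^ n := one_le_pow₀ hb.le
  change ∫ τ in (1:ℝ)..t, g (geomBlock b τ) / τ = _ + g n * _
  rw [← intervalIntegral.integral_add_adjacent_intervals (hint 1 (b ^ n) le_rfl hn)
    (hint (b ^ n) t hn (hn.trans h₁)), key, integral_geomBlock_div g hb h₁ h₂]

theorem RO.exists_representation {α : ℝ → ℝ} (h : RO α) : ∃ β γ : ℝ → ℝ,
      Measurable ((Set.Ici (1:ℝ)).domRestrict β) ∧
      Measurable ((Set.Ici (1:ℝ)).domRestrict γ) ∧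
      (∃ M : ℝ, ∀ t, 1 ≤ t → |β t| ≤ M) ∧
      (∃ M : ℝ, ∀ t, 1 ≤ t → |γ t| ≤ M) ∧
      (∀ t, 1 ≤ t → α t = Real.exp (β t + ∫ τ in (1:ℝ)..t, γ τ / τ)) := by
  obtain ⟨hmeas, hpos, b, hb, c, hc, hα⟩ := h
  have hlb := Real.log_pos hb
  have hosc : ∀ s t, 1 ≤ s → s ≤ t → t ≤ b * s →
      |Real.log (α t) - Real.log (α s)| ≤ Real.log c := by
    intro s t hs hst htb
    have hs0 : 0 < s := by linarith
    obtain ⟨h₁, h₂⟩ := hα s hs (t / s) ((one_le_div hs0).2 hst) ((div_le_iff₀ hs0).2 htb)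
    rw [div_mul_cancel₀ _ hs0.ne'] at h₁ h₂
    have hs' := hpos s hs
    have ht' := hpos t (hs.trans hst)
    rw [← Real.log_div ht'.ne' hs'.ne', abs_le, ← Real.log_inv]
    exact ⟨Real.log_le_log (by positivity) h₁, Real.log_le_log (by positivity) h₂⟩
  set f : ℝ → ℝ := fun t => Real.log (α t)
  set g : ℕ → ℝ := fun n => (f (b ^ (n + 1)) - f (b ^ n)) / Real.log b
  have hK : ∀ n : ℕ, |g n| ≤ Real.log c / Real.log b := by
    intro n
    simp only [g]
    rw [abs_div, abs_of_pos hlb]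
    gcongr
    exact hosc _ _ (one_le_pow₀ hb.le) (pow_le_pow_right₀ hb.le n.le_succ) (by rw [pow_succ'])
  have hg : Measurable fun t => g (geomBlock b t) :=
    (measurable_from_nat (f := g)).comp (measurable_geomBlock b)
  set P : ℝ → ℝ := fun t =>
    f (b ^ geomBlock b t) - f 1 +
      g (geomBlock b t) * (Real.log t - geomBlock b t * Real.log b)
  have hP : Measurable P :=
    (((measurable_from_nat (f := fun n : ℕ => f (b ^ n))).comp
      (measurable_geomBlock b)).sub_const _).add
      (hg.mul (Real.measurable_log.sub
        ((measurable_from_nat.comp (measurable_geomBlock b)).mul_const _)))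
  refine ⟨fun t => f t - P t, fun t => g (geomBlock b t), ?_, hg.comp measurable_subtype_coe,
    ⟨|f 1| + 2 * Real.log c, fun t ht => ?_⟩, ⟨_, fun t _ => hK _⟩, fun t ht => ?_⟩
  · exact (Real.measurable_log.comp hmeas).sub (hP.comp measurable_subtype_coe)
  · have h₁ := geomBlock_le hb ht
    have h₂ := (lt_geomBlock_succ hb ht).le
    set n := geomBlock b t with hn
    have hfn := hosc (b ^ n) t (one_le_pow₀ hb.le) h₁ (by rwa [← pow_succ'])
    have hlog₁ : 0 ≤ Real.log t - n * Real.log b := by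
      have := Real.log_le_log (by positivity) h₁
      rw [Real.log_pow] at this
      linarith
    have hlog₂ : Real.log t - n * Real.log b ≤ Real.log b := by
      have := Real.log_le_log (by linarith) h₂
      rw [Real.log_pow] at this
      push_cast at this
      linarith
    have hgn : |g n * (Real.log t - n * Real.log b)| ≤ Real.log c := by
      rw [abs_mul, abs_of_nonneg hlog₁]
      calc _ ≤ Real.log c / Real.log b * Real.log b :=
            mul_le_mul (hK n) hlog₂ hlog₁ (div_nonneg (Real.log_nonneg hc) hlb.le)
        _ = _ := div_mul_cancel₀ _ hlb.ne'
    have heq : f t - P t = (f t - f (b ^ n)) + f 1 - g n * (Real.log t - n * Real.log b) := by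
      simp only [P, ← hn]
      ring
    simp only [heq]
    have := abs_sub (f t - f (b ^ n) + f 1) (g n * (Real.log t - n * Real.log b))
    have := abs_add_le (f t - f (b ^ n)) (f 1)
    have : |f t - f (b ^ n)| ≤ Real.log c := hfn
    linarith
  · have := integral_logSlope f hb hK (geomBlock_le hb ht) (lt_geomBlock_succ hb ht).le
    change α t = Real.exp (f t - P t + ∫ τ in (1:ℝ)..t,
      (f (b ^ (geomBlock b τ + 1)) - f (b ^ geomBlock b τ)) / Real.log b / τ)
    rw [this]
    change α t = Real.exp (f t - P t + P t)
    rw [sub_add_cancel, Real.exp_log (hpos t ht)]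

theorem RO.of_representation {α β γ : ℝ → ℝ}
    (hmeas : Measurable ((Set.Ici (1:ℝ)).domRestrict α))
    (hγ : Measurable ((Set.Ici (1:ℝ)).domRestrict γ))
    {M N : ℝ} (hM : ∀ t, 1 ≤ t → |β t| ≤ M) (hN : ∀ t, 1 ≤ t → |γ t| ≤ N)
    (hα : ∀ t, 1 ≤ t → α t = Real.exp (β t + ∫ τ in (1:ℝ)..t, γ τ / τ)) : RO α := by
  have hM0 : 0 ≤ M := (abs_nonneg _).trans (hM 1 le_rfl)
  have hN0 : 0 ≤ N := (abs_nonneg _).trans (hN 1 le_rfl)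
  refine ⟨hmeas, fun t ht => hα t ht ▸ Real.exp_pos _, 2, one_lt_two, Real.exp (2 * M + N),
    Real.one_le_exp (by positivity), fun t ht l hl hl2 => ?_⟩
  have ht0 : 0 < t := by linarith
  have hlt : t ≤ l * t := le_mul_of_one_le_left ht0.le hl
  have hlt1 : 1 ≤ l * t := ht.trans hlt
  have hI : |∫ τ in t..(l * t), γ τ / τ| ≤ N := by
    have hbound : ∀ τ ∈ Set.uIoc t (l * t), ‖γ τ / τ‖ ≤ N / t := by
      intro τ hτ
      rw [Set.uIoc_of_le hlt] at hτ
      have hτ0 : 0 < τ := ht0.trans hτ.1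
      rw [Real.norm_eq_abs, abs_div, abs_of_pos hτ0]
      exact div_le_div₀ hN0 (hN τ (ht.trans hτ.1.le)) ht0 hτ.1.le
    have := intervalIntegral.norm_integral_le_of_norm_le_const hbound
    rw [Real.norm_eq_abs, abs_of_nonneg (sub_nonneg.2 hlt)] at this
    calc _ ≤ _ := this
      _ = N * (l - 1) := by field_simp
      _ ≤ N := mul_le_of_le_one_right hN0 (by linarith)
  rw [hα _ hlt1, hα t ht, ← Real.exp_sub, ← Real.exp_neg, Real.exp_le_exp, Real.exp_le_exp,
    ← intervalIntegral.integral_add_adjacent_intervals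
      (intervalIntegrable_div_of_bounded hγ hN le_rfl ht)
      (intervalIntegrable_div_of_bounded hγ hN ht hlt1)]
  have h₁ := abs_le.1 hI
  have h₂ := abs_le.1 (hM t ht)
  have h₃ := abs_le.1 (hM _ hlt1)
  constructor <;> linarith

/-- A Borel measurable positive function `α` on `[1,∞)` belongs to RO if and only if
`α(t) = exp(β(t) + ∫₁ᵗ γ(τ)/τ dτ)` for some bounded Borel measurable `β, γ` on `[1,∞)`. -/
theorem RO_iff_representation (α : ℝ → ℝ)
    (hmeas : Measurable ((Set.Ici (1:ℝ)).restrict α))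
    (hpos : ∀ t, 1 ≤ t → 0 < α t) :
    RO α ↔ ∃ β γ : ℝ → ℝ,
      Measurable ((Set.Ici (1:ℝ)).restrict β) ∧
      Measurable ((Set.Ici (1:ℝ)).restrict γ) ∧
      (∃ M : ℝ, ∀ t, 1 ≤ t → |β t| ≤ M) ∧
      (∃ M : ℝ, ∀ t, 1 ≤ t → |γ t| ≤ M) ∧
      (∀ t, 1 ≤ t → α t = Real.exp (β t + ∫ τ in (1:ℝ)..t, γ τ / τ)) := by
  exact ⟨RO.exists_representation, fun ⟨_, _, _, hγ, ⟨_, hM⟩, ⟨_, hN⟩, hα⟩ =>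
    RO.of_representation hmeas hγ hM hN hα⟩
end
end

section
/- Let n ≥ 1 be an integer and α, η ∈ RO. Then the following are equivalent: (i) there is a constant C > 0 such that ∫_{ℝⁿ} α(⟨ξ⟩)²|g(ξ)|² dξ ≤ C·∫_{ℝⁿ} η(⟨ξ⟩)²|g(ξ)|² dξ for every measurable function g : ℝⁿ → ℂ (inequality in the extended reals); (ii) the function α/η is bounded on [1,∞). In terms of Hörmander spaces, (i) expresses the continuous embedding H^{η}(ℝⁿ) ↪ H^{α}(ℝⁿ). -/
noncomputable section

open MeasureTheory

/-- The smoothed modulus `⟨ξ⟩ = (1 + |ξ|²)^{1/2}`. -/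
def smod {n : ℕ} (ξ : EuclideanSpace ℝ (Fin n)) : ℝ := Real.sqrt (1 + ‖ξ‖ ^ 2)

theorem continuous_smod {n : ℕ} : Continuous (smod (n := n)) := by
  unfold smod
  fun_prop

theorem one_le_smod {n : ℕ} (ξ : EuclideanSpace ℝ (Fin n)) : 1 ≤ smod ξ :=
  Real.one_le_sqrt.2 (by nlinarith [sq_nonneg ‖ξ‖])

theorem norm_le_smod {n : ℕ} (ξ : EuclideanSpace ℝ (Fin n)) : ‖ξ‖ ≤ smod ξ :=
  Real.le_sqrt_of_sq_le (by linarith)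

theorem exists_smod_eq {n : ℕ} (hn : 1 ≤ n) {s : ℝ} (hs : 1 ≤ s) :
    ∃ ξ : EuclideanSpace ℝ (Fin n), smod ξ = s := by
  refine ⟨EuclideanSpace.single ⟨0, hn⟩ (Real.sqrt (s ^ 2 - 1)), ?_⟩
  have h : 0 ≤ s ^ 2 - 1 := by nlinarith
  rw [smod, PiLp.norm_single, Real.norm_of_nonneg (Real.sqrt_nonneg _), Real.sq_sqrt h,
    add_sub_cancel, Real.sqrt_sq (by linarith)]

/-- The open spherical shell on which the smoothed modulus lies strictly between `s` and `t`. -/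
def shell (n : ℕ) (s t : ℝ) : Set (EuclideanSpace ℝ (Fin n)) := smod ⁻¹' Set.Ioo s t

theorem isOpen_shell (n : ℕ) (s t : ℝ) : IsOpen (shell n s t) :=
  isOpen_Ioo.preimage continuous_smod

theorem volume_shell_pos {n : ℕ} (hn : 1 ≤ n) {s t : ℝ} (hs : 1 ≤ s) (hst : s < t) :
    0 < volume (shell n s t) := by
  refine (isOpen_shell n s t).measure_pos volume ?_
  obtain ⟨ξ, hξ⟩ := exists_smod_eq hn (s := (s + t) / 2) (by linarith)
  exact ⟨ξ, by simp only [shell, Set.mem_preimage, hξ]; constructor <;> linarith⟩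

theorem volume_shell_lt_top (n : ℕ) (s t : ℝ) : volume (shell n s t) < ⊤ := by
  refine (measure_mono fun ξ hξ => ?_).trans_lt
    (measure_closedBall_lt_top (x := (0 : EuclideanSpace ℝ (Fin n))) (r := t))
  rw [mem_closedBall_zero_iff]
  exact (norm_le_smod ξ).trans hξ.2.le

theorem RO.pos {α : ℝ → ℝ} (hα : RO α) {t : ℝ} (ht : 1 ≤ t) : 0 < α t := hα.2.1 t ht

/-- On each interval `[t, bt]` a function of class RO is comparable to its value at `t`. -/
theorem RO.exists_comparable {α : ℝ → ℝ} (hα : RO α) :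
    ∃ b : ℝ, 1 < b ∧ ∃ c : ℝ, 1 ≤ c ∧ ∀ t, 1 ≤ t → ∀ s, t ≤ s → s ≤ b * t →
      α t ≤ c * α s ∧ α s ≤ c * α t := by
  obtain ⟨-, hpos, b, hb, c, hc, h⟩ := hα
  refine ⟨b, hb, c, hc, fun t ht s hts hsb => ?_⟩
  have ht0 : 0 < t := by linarith
  obtain ⟨h1, h2⟩ := h t ht (s / t) ((one_le_div ht0).2 hts) ((div_le_iff₀ ht0).2 hsb)
  rw [div_mul_cancel₀ s ht0.ne'] at h1 h2
  rw [le_div_iff₀ (hpos t ht), inv_mul_le_iff₀ (by linarith)] at h1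
  exact ⟨h1, (div_le_iff₀ (hpos t ht)).1 h2⟩

theorem lintegral_le_of_ratio_le {n : ℕ} {α η : ℝ → ℝ} (hα : RO α) (hη : RO η) {M : ℝ}
    (hM : ∀ t, 1 ≤ t → α t / η t ≤ M) (g : EuclideanSpace ℝ (Fin n) → ℂ) :
    (∫⁻ ξ, ENNReal.ofReal (α (smod ξ) ^ 2 * ‖g ξ‖ ^ 2)) ≤
      ENNReal.ofReal (M ^ 2) * ∫⁻ ξ, ENNReal.ofReal (η (smod ξ) ^ 2 * ‖g ξ‖ ^ 2) := by
  rw [← lintegral_const_mul' _ _ ENNReal.ofReal_ne_top]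
  refine lintegral_mono fun ξ => ?_
  rw [← ENNReal.ofReal_mul (sq_nonneg M), ← mul_assoc, ← mul_pow M]
  have h1 := one_le_smod ξ
  have := (div_le_iff₀ (hη.pos h1)).1 (hM _ h1)
  have := (hα.pos h1).le
  gcongr

/-- Testing a weighted `L²` estimate on the indicator function of a set of positive finite
measure compares a lower bound of one weight with an upper bound of the other. -/
theorem weight_le_of_lintegral_indicator_le {E : Type*} [MeasurableSpace E] {μ : Measure E}
    {A : Set E} (hA : MeasurableSet A) (hA0 : μ A ≠ 0) (hAtop : μ A ≠ ⊤) {u v : E → ℝ}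
    {p q C : ℝ} (hC : 0 ≤ C) (hq : 0 ≤ q) (hp : ∀ x ∈ A, p ≤ u x) (hv : ∀ x ∈ A, v x ≤ q)
    (h : (∫⁻ x, ENNReal.ofReal (u x * ‖A.indicator (1 : E → ℂ) x‖ ^ 2) ∂μ) ≤
      ENNReal.ofReal C * ∫⁻ x, ENNReal.ofReal (v x * ‖A.indicator (1 : E → ℂ) x‖ ^ 2) ∂μ) :
    p ≤ C * q := by
  have key (w : E → ℝ) :
      (∫⁻ x, ENNReal.ofReal (w x * ‖A.indicator (1 : E → ℂ) x‖ ^ 2) ∂μ) =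
        ∫⁻ x in A, ENNReal.ofReal (w x) ∂μ := by
    rw [← lintegral_indicator hA]
    refine lintegral_congr fun x => ?_
    by_cases hx : x ∈ A <;> simp [hx]
  rw [key, key] at h
  have hlow : ENNReal.ofReal p * μ A ≤ ∫⁻ x in A, ENNReal.ofReal (u x) ∂μ := by
    rw [← setLIntegral_const]
    exact setLIntegral_mono' hA fun x hx => ENNReal.ofReal_le_ofReal (hp x hx)
  have hup : (∫⁻ x in A, ENNReal.ofReal (v x) ∂μ) ≤ ENNReal.ofReal q * μ A := by
    rw [← setLIntegral_const]
    exact setLIntegral_mono' hA fun x hx => ENNReal.ofReal_le_ofReal (hv x hx)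
  have hle := hlow.trans (h.trans (mul_le_mul_right hup _))
  rw [← mul_assoc, ENNReal.mul_le_mul_iff_left hA0 hAtop, ← ENNReal.ofReal_mul hC] at hle
  exact (ENNReal.ofReal_le_ofReal_iff (mul_nonneg hC hq)).1 hle

/-- For `α, η ∈ RO`, the continuous embedding `H^{η}(ℝⁿ) ↪ H^{α}(ℝⁿ)` (i.e. the weighted
`L²` estimate for all measurable `g`) holds if and only if `α/η` is bounded on `[1,∞)`. -/
theorem hormander_embedding_iff_ratio_bounded (n : ℕ) (hn : 1 ≤ n)
    (α η : ℝ → ℝ) (hα : RO α) (hη : RO η) :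
    (∃ C : ℝ, 0 < C ∧ ∀ g : EuclideanSpace ℝ (Fin n) → ℂ, Measurable g →
        (∫⁻ ξ, ENNReal.ofReal (α (smod ξ) ^ 2 * ‖g ξ‖ ^ 2)) ≤
          ENNReal.ofReal C * ∫⁻ ξ, ENNReal.ofReal (η (smod ξ) ^ 2 * ‖g ξ‖ ^ 2)) ↔
    (∃ M : ℝ, ∀ t, 1 ≤ t → α t / η t ≤ M) := by
  constructor
  · rintro ⟨C, hC, h⟩
    obtain ⟨b, hb, c, hc, hαb⟩ := hα.exists_comparable
    obtain ⟨b', hb', c', hc', hηb⟩ := hη.exists_comparable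
    refine ⟨Real.sqrt C * (c * c'), fun t ht => ?_⟩
    have ht0 : 0 < t := by linarith
    have hαt := hα.pos ht
    have hηt := hη.pos ht
    have hA : MeasurableSet (shell n t (min b b' * t)) := (isOpen_shell n _ _).measurableSet
    have hlt : t < min b b' * t := lt_mul_of_one_lt_left ht0 (lt_min hb hb')
    have hbound : (α t / c) ^ 2 ≤ C * (c' * η t) ^ 2 := by
      refine weight_le_of_lintegral_indicator_le hA (volume_shell_pos hn ht hlt).ne'
        (volume_shell_lt_top n _ _).ne hC.le (sq_nonneg _) (fun ξ hξ => ?_) (fun ξ hξ => ?_)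
        (h _ (measurable_one.indicator hA))
      · have := (hαb t ht _ hξ.1.le
          (hξ.2.le.trans (mul_le_mul_of_nonneg_right (min_le_left _ _) ht0.le))).1
        gcongr
        rwa [div_le_iff₀' (by linarith)]
      · have := (hηb t ht _ hξ.1.le
          (hξ.2.le.trans (mul_le_mul_of_nonneg_right (min_le_right _ _) ht0.le))).2
        have := hη.pos (one_le_smod ξ)
        gcongr
    rw [← Real.sq_sqrt hC.le, ← mul_pow] at hbound
    have hle := (sq_le_sq₀ (by positivity) (by positivity)).1 hbound
    rw [div_le_iff₀ (by linarith)] at hle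
    rw [div_le_iff₀ hηt]
    linarith
  · rintro ⟨M, hM⟩
    have hM0 : 0 < M := (div_pos (hα.pos le_rfl) (hη.pos le_rfl)).trans_le (hM 1 le_rfl)
    exact ⟨M ^ 2, by positivity, fun g _ => lintegral_le_of_ratio_le hα hη hM g⟩
end
end

section
/- (Gohberg–Krein lemma.) Let E be a Banach space, let R ⊆ E be a closed linear subspace of finite codimension, and let D ⊆ E be a dense linear subspace. Then there exists a finite-dimensional linear subspace G ⊆ D such that E is the direct sum of G and R, i.e., G ∩ R = {0} and G + R = E; in particular dim G equals the codimension of R in E. -/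
/-- A dense subspace surjects onto the quotient by a closed subspace of finite codimension. -/
theorem Submodule.surjective_mkQ_comp_subtype_of_dense {𝕜 E : Type*}
    [NontriviallyNormedField 𝕜] [CompleteSpace 𝕜] [NormedAddCommGroup E] [NormedSpace 𝕜 E]
    (R : Submodule 𝕜 E) (hR : IsClosed (R : Set E)) [FiniteDimensional 𝕜 (E ⧸ R)]
    (D : Submodule 𝕜 E) (hD : Dense (D : Set E)) :
    Function.Surjective (R.mkQ ∘ₗ D.subtype) := by
  have : IsClosed (R : Set E) := hR
  rw [← LinearMap.range_eq_top, LinearMap.range_comp, Submodule.range_subtype]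
  have hdense : Dense (D.map R.mkQ : Set (E ⧸ R)) := by
    rw [Submodule.map_coe]
    exact R.mkQ_surjective.denseRange.dense_image continuous_quot_mk hD
  exact SetLike.coe_injective
    ((D.map R.mkQ).closed_of_finiteDimensional.closure_eq.symm.trans hdense.closure_eq)

/-- The range of a linear section of the quotient map is a complement of the subspace. -/
theorem Submodule.isCompl_range_of_mkQ_comp_eq_id {K V : Type*} [Ring K] [AddCommGroup V]
    [Module K V] (R : Submodule K V) (s : V ⧸ R →ₗ[K] V) (hs : R.mkQ ∘ₗ s = LinearMap.id) :
    IsCompl (LinearMap.range s) R := by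
  have hsx (x : V ⧸ R) : R.mkQ (s x) = x := LinearMap.congr_fun hs x
  constructor
  · rw [Submodule.disjoint_def]
    rintro _ ⟨x, rfl⟩ hx
    have hzero : x = 0 := by
      rw [← hsx x]
      exact (Submodule.Quotient.mk_eq_zero R).2 hx
    rw [hzero, map_zero]
  · rw [codisjoint_iff, Submodule.eq_top_iff']
    intro x
    refine Submodule.mem_sup.2 ⟨s (R.mkQ x), ⟨_, rfl⟩, x - s (R.mkQ x), ?_, by abel⟩
    rw [← Submodule.Quotient.mk_eq_zero R, ← Submodule.mkQ_apply, map_sub, hsx, sub_self]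

/-- **Gohberg–Krein lemma.** If `R` is a closed subspace of finite codimension of a Banach
space `E` and `D` is a dense subspace of `E`, then there is a finite-dimensional subspace
`G ⊆ D` with `G ∩ R = {0}` and `G + R = E`; in particular `dim G = codim R`. -/
theorem gohberg_krein_lemma {E : Type*}
    [NormedAddCommGroup E] [NormedSpace ℂ E] [CompleteSpace E]
    (R : Submodule ℂ E) (hRclosed : IsClosed (R : Set E))
    (hRcodim : FiniteDimensional ℂ (E ⧸ R))
    (D : Submodule ℂ E) (hD : Dense (D : Set E)) :
    ∃ G : Submodule ℂ E, G ≤ D ∧ FiniteDimensional ℂ G ∧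
      G ⊓ R = ⊥ ∧ G ⊔ R = ⊤ ∧
      Module.finrank ℂ G = Module.finrank ℂ (E ⧸ R) := by
  obtain ⟨t, ht⟩ := (R.mkQ ∘ₗ D.subtype).exists_rightInverse_of_surjective
    (LinearMap.range_eq_top.2 (R.surjective_mkQ_comp_subtype_of_dense hRclosed D hD))
  have hs : R.mkQ ∘ₗ (D.subtype ∘ₗ t) = LinearMap.id := ht
  have hcompl := R.isCompl_range_of_mkQ_comp_eq_id _ hs
  refine ⟨LinearMap.range (D.subtype ∘ₗ t), ?_, inferInstance, hcompl.inf_eq_bot,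
    hcompl.sup_eq_top, LinearMap.finrank_range_of_inj ?_⟩
  · rintro _ ⟨x, rfl⟩
    exact (t x).2
  · exact Function.LeftInverse.injective (g := R.mkQ) (LinearMap.congr_fun hs)
end

section
/- (Second Green identity for the Laplacian on the unit disk.) Let u, v : ℝ² → ℂ be infinitely differentiable. Then ∫_{B} (Δu(x)·conj(v(x)) − u(x)·conj(Δv(x))) dx = ∫₀^{2π} ( −∂ν u(γ(φ))·conj(v(γ(φ))) + u(γ(φ))·conj(∂ν v(γ(φ))) ) dφ, where B is the open unit ball in ℝ² and the integral over B is with respect to two-dimensional Lebesgue measure. -/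
noncomputable section

open Real MeasureTheory ComplexConjugate

/-- The Euclidean plane. -/
abbrev Plane := EuclideanSpace ℝ (Fin 2)

/-- The boundary point `γ(φ) = (cos φ, sin φ)` of the unit disk. -/
def gam (φ : ℝ) : Plane := (WithLp.equiv 2 (Fin 2 → ℝ)).symm ![Real.cos φ, Real.sin φ]

/-- The Laplacian `Δf = ∑ᵢ ∂²f/∂xᵢ²`. -/
def lap (f : Plane → ℂ) (x : Plane) : ℂ :=
  ∑ i : Fin 2, fderiv ℝ (fun y => fderiv ℝ f y (EuclideanSpace.single i 1)) x
    (EuclideanSpace.single i 1)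

/-- The inward normal derivative `∂ν f(γ(φ)) = −(d/dr) f(r·γ(φ)) |_{r=1}`. -/
def nder (f : Plane → ℂ) (φ : ℝ) : ℂ := -deriv (fun r : ℝ => f (r • gam φ)) 1

theorem gam_eq (φ : ℝ) : gam φ =
    cos φ • EuclideanSpace.single 0 1 + sin φ • EuclideanSpace.single 1 1 := by
  ext i
  fin_cases i <;> simp [gam]

theorem norm_gam (φ : ℝ) : ‖gam φ‖ = 1 := by
  simp [gam, EuclideanSpace.norm_eq]

theorem contDiff_gam {n : WithTop ℕ∞} : ContDiff ℝ n gam := by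
  rw [show gam = _ from funext gam_eq]
  exact (contDiff_cos.smul contDiff_const).add (contDiff_sin.smul contDiff_const)

theorem gam_periodic : Function.Periodic gam (2 * π) := fun φ => by simp [gam]

theorem clm_gam {F : Type*} [NormedAddCommGroup F] [NormedSpace ℝ F] (L : Plane →L[ℝ] F) (φ : ℝ) :
    L (gam φ) = cos φ • L (EuclideanSpace.single 0 1) + sin φ • L (EuclideanSpace.single 1 1) := by
  rw [gam_eq, map_add, map_smul, map_smul]

/-- The derivative of the polar parametrisation `(r, φ) ↦ r γ(φ)`. -/
theorem hasFDerivAt_smul_gam (p : ℝ × ℝ) :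
    HasFDerivAt (fun p : ℝ × ℝ => p.1 • gam p.2)
      ((ContinuousLinearMap.fst ℝ ℝ ℝ).smulRight (gam p.2) +
        (ContinuousLinearMap.snd ℝ ℝ ℝ).smulRight
          (p.1 • (-sin p.2 • EuclideanSpace.single 0 1 + cos p.2 • EuclideanSpace.single 1 1))) p := by
  have hg : HasDerivAt gam
      (-sin p.2 • EuclideanSpace.single 0 1 + cos p.2 • EuclideanSpace.single 1 1) p.2 := by
    rw [show gam = _ from funext gam_eq]
    exact ((hasDerivAt_cos p.2).smul_const _).add ((hasDerivAt_sin p.2).smul_const _)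
  have h : HasFDerivAt (fun p : ℝ × ℝ => p.1 • gam p.2) _ p :=
    (hasFDerivAt_fst (𝕜 := ℝ) (p := p)).fun_smul
      (hg.hasFDerivAt.comp p (hasFDerivAt_snd (𝕜 := ℝ) (p := p)))
  refine h.congr_fderiv ?_
  ext <;> simp

theorem smul_gam_mem_ball {r : ℝ} (hr : 0 < r) (φ : ℝ) :
    r • gam φ ∈ Metric.ball (0 : Plane) 1 ↔ r < 1 := by
  rw [mem_ball_zero_iff, norm_smul, norm_gam, mul_one, norm_of_nonneg hr.le]

/-- Integration over the unit disk in polar coordinates. -/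
theorem integral_ball_eq_polar (f : Plane → ℂ) (hf : Continuous f) :
    ∫ x in Metric.ball (0 : Plane) 1, f x =
      ∫ r in (0:ℝ)..1, ∫ φ in (-π)..π, r • f (r • gam φ) := by
  have hm : MeasurePreserving
      (((MeasurableEquiv.toLp 2 (Fin 2 → ℝ)).symm.trans MeasurableEquiv.finTwoArrow).symm :
        ℝ × ℝ → Plane) volume volume :=
    ((volume_preserving_finTwoArrow ℝ).comp
      (EuclideanSpace.volume_preserving_symm_measurableEquiv_toLp (Fin 2))).symm
      ((MeasurableEquiv.toLp 2 (Fin 2 → ℝ)).symm.trans MeasurableEquiv.finTwoArrow)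
  have hpol : ∀ p : ℝ × ℝ,
      ((MeasurableEquiv.toLp 2 (Fin 2 → ℝ)).symm.trans MeasurableEquiv.finTwoArrow).symm
        (polarCoord.symm p) = p.1 • gam p.2 := by
    intro p
    ext i
    fin_cases i <;> simp [gam, MeasurableEquiv.finTwoArrow, polarCoord]
  have hcont : Continuous fun p : ℝ × ℝ => p.1 • f (p.1 • gam p.2) := by
    have := (contDiff_gam (n := 0)).continuous
    fun_prop
  have hint : IntegrableOn (fun p : ℝ × ℝ => p.1 • f (p.1 • gam p.2))
      (Set.Ioc 0 1 ×ˢ Set.Ioc (-π) π) (volume.prod volume) :=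
    (hcont.continuousOn.integrableOn_compact (isCompact_Icc.prod isCompact_Icc)).mono_set
      (Set.prod_mono Set.Ioc_subset_Icc_self Set.Ioc_subset_Icc_self)
  have hset : Set.Ioo (0:ℝ) 1 ×ˢ Set.Ioo (-π) π =ᵐ[volume.prod volume]
      Set.Ioc (0:ℝ) 1 ×ˢ Set.Ioc (-π) π :=
    Measure.set_prod_ae_eq Ioo_ae_eq_Ioc Ioo_ae_eq_Ioc
  rw [← integral_indicator measurableSet_ball, ← hm.integral_comp', ← integral_comp_polarCoord_symm]
  simp_rw [hpol]
  have htarget : polarCoord.target = Set.Ioi (0:ℝ) ×ˢ Set.Ioo (-π) π := rfl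
  calc ∫ p in polarCoord.target, p.1 • (Metric.ball (0 : Plane) 1).indicator f (p.1 • gam p.2)
      = ∫ p in polarCoord.target, (Set.Ioo (0:ℝ) 1 ×ˢ Set.Ioo (-π) π).indicator
          (fun p : ℝ × ℝ => p.1 • f (p.1 • gam p.2)) p := by
        refine setIntegral_congr_fun polarCoord.open_target.measurableSet fun p hp => ?_
        rw [htarget] at hp
        by_cases h1 : p.1 < 1
        · have h2 : p ∈ Set.Ioo (0:ℝ) 1 ×ˢ Set.Ioo (-π) π := ⟨⟨hp.1, h1⟩, hp.2⟩
          simp only [Set.indicator_of_mem h2,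
            Set.indicator_of_mem ((smul_gam_mem_ball hp.1 p.2).2 h1)]
        · have h2 : p ∉ Set.Ioo (0:ℝ) 1 ×ˢ Set.Ioo (-π) π := fun h => h1 h.1.2
          simp only [Set.indicator_of_notMem h2,
            Set.indicator_of_notMem (fun h => h1 ((smul_gam_mem_ball hp.1 p.2).1 h)), smul_zero]
    _ = ∫ p in Set.Ioo (0:ℝ) 1 ×ˢ Set.Ioo (-π) π, p.1 • f (p.1 • gam p.2) := by
        rw [setIntegral_indicator (measurableSet_Ioo.prod measurableSet_Ioo),
          Set.inter_eq_self_of_subset_right]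
        rw [htarget]
        exact Set.prod_mono Set.Ioo_subset_Ioi_self le_rfl
    _ = ∫ p in Set.Ioc (0:ℝ) 1 ×ˢ Set.Ioc (-π) π, p.1 • f (p.1 • gam p.2) :=
        setIntegral_congr_set hset
    _ = ∫ r in Set.Ioc (0:ℝ) 1, ∫ φ in Set.Ioc (-π) π, r • f (r • gam φ) :=
        setIntegral_prod _ hint
    _ = _ := by
        rw [intervalIntegral.integral_of_le zero_le_one]
        simp_rw [intervalIntegral.integral_of_le (neg_le_self pi_pos.le)]

/-- The divergence theorem on the unit disk. -/
theorem integral_ball_divergence (P Q : Plane → ℂ) (hP : ContDiff ℝ 1 P) (hQ : ContDiff ℝ 1 Q) :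
    ∫ x in Metric.ball (0 : Plane) 1, (fderiv ℝ P x (EuclideanSpace.single 0 1) +
        fderiv ℝ Q x (EuclideanSpace.single 1 1)) =
      ∫ φ in (-π)..π, (cos φ • P (gam φ) + sin φ • Q (gam φ)) := by
  have hpol : ContDiff ℝ 1 fun p : ℝ × ℝ => p.1 • gam p.2 :=
    contDiff_fst.smul (contDiff_gam.comp contDiff_snd)
  have hcos : ContDiff ℝ 1 fun p : ℝ × ℝ => cos p.2 := contDiff_cos.comp contDiff_snd
  have hsin : ContDiff ℝ 1 fun p : ℝ × ℝ => sin p.2 := contDiff_sin.comp contDiff_snd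
  set f : ℝ × ℝ → ℂ := fun p =>
    p.1 • (cos p.2 • P (p.1 • gam p.2) + sin p.2 • Q (p.1 • gam p.2)) with hf
  set g : ℝ × ℝ → ℂ := fun p =>
    (-sin p.2) • P (p.1 • gam p.2) + cos p.2 • Q (p.1 • gam p.2) with hg
  have hfC : ContDiff ℝ 1 f := contDiff_fst.smul
    ((hcos.smul (hP.comp hpol)).add (hsin.smul (hQ.comp hpol)))
  have hgC : ContDiff ℝ 1 g := (hsin.neg.smul (hP.comp hpol)).add (hcos.smul (hQ.comp hpol))
  have hdiv : ∀ p : ℝ × ℝ, fderiv ℝ f p (1, 0) + fderiv ℝ g p (0, 1) =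
      p.1 • (fderiv ℝ P (p.1 • gam p.2) (EuclideanSpace.single 0 1) +
        fderiv ℝ Q (p.1 • gam p.2) (EuclideanSpace.single 1 1)) := by
    intro p
    have hP' := ((hP.differentiable one_ne_zero (p.1 • gam p.2)).hasFDerivAt).comp p
      (hasFDerivAt_smul_gam p)
    have hQ' := ((hQ.differentiable one_ne_zero (p.1 • gam p.2)).hasFDerivAt).comp p
      (hasFDerivAt_smul_gam p)
    have hc := (hasDerivAt_cos p.2).hasFDerivAt.comp p (hasFDerivAt_snd (𝕜 := ℝ) (p := p))
    have hs := (hasDerivAt_sin p.2).hasFDerivAt.comp p (hasFDerivAt_snd (𝕜 := ℝ) (p := p))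
    have hf' : HasFDerivAt f _ p :=
      (hasFDerivAt_fst (𝕜 := ℝ) (p := p)).fun_smul ((hc.fun_smul hP').fun_add (hs.fun_smul hQ'))
    have hg' : HasFDerivAt g _ p := (hs.fun_neg.fun_smul hP').fun_add (hc.fun_smul hQ')
    rw [hf'.fderiv, hg'.fderiv]
    simp [clm_gam]
    linear_combination (p.1 * (fderiv ℝ P (p.1 • gam p.2) (EuclideanSpace.single 0 1) +
      fderiv ℝ Q (p.1 • gam p.2) (EuclideanSpace.single 1 1)))
      * Complex.cos_sq_add_sin_sq p.2
  rw [integral_ball_eq_polar _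
    (((hP.continuous_fderiv one_ne_zero).clm_apply continuous_const).fun_add
      ((hQ.continuous_fderiv one_ne_zero).clm_apply continuous_const))]
  have key := integral2_divergence_prod_of_hasFDerivAt f g (fderiv ℝ f) (fderiv ℝ g) 0 (-π) 1 π
    hfC.continuous.continuousOn hgC.continuous.continuousOn
    (fun x _ => (hfC.differentiable one_ne_zero x).hasFDerivAt)
    (fun x _ => (hgC.differentiable one_ne_zero x).hasFDerivAt)
    ((((hfC.continuous_fderiv one_ne_zero).clm_apply continuous_const).fun_add
      ((hgC.continuous_fderiv one_ne_zero).clm_apply continuous_const)).continuousOn.integrableOn_compact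
      (isCompact_uIcc.prod isCompact_uIcc))
  simp_rw [hdiv] at key
  rw [key]
  simp [hf, hg, gam]

theorem nder_eq (f : Plane → ℂ) (hf : Differentiable ℝ f) (φ : ℝ) :
    nder f φ = -(cos φ • fderiv ℝ f (gam φ) (EuclideanSpace.single 0 1) +
      sin φ • fderiv ℝ f (gam φ) (EuclideanSpace.single 1 1)) := by
  have h1 : HasDerivAt (fun r : ℝ => r • gam φ) ((1:ℝ) • gam φ) 1 :=
    (hasDerivAt_id (1:ℝ)).smul_const (gam φ)
  have h2 : HasDerivAt (fun r : ℝ => f (r • gam φ)) _ 1 :=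
    (hf ((1:ℝ) • gam φ)).hasFDerivAt.comp_hasDerivAt (1:ℝ) h1
  rw [nder, ← clm_gam, h2.deriv, one_smul]

theorem fderiv_green_component (u v : Plane → ℂ)
    (hu : ContDiff ℝ (⊤ : ℕ∞) u) (hv : ContDiff ℝ (⊤ : ℕ∞) v) (e x : Plane) :
    fderiv ℝ (fun y => fderiv ℝ u y e * conj (v y) - u y * conj (fderiv ℝ v y e)) x e =
      fderiv ℝ (fun y => fderiv ℝ u y e) x e * conj (v x) -
        u x * conj (fderiv ℝ (fun y => fderiv ℝ v y e) x e) := by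
  have hd : ∀ w : Plane → ℂ, ContDiff ℝ (⊤ : ℕ∞) w →
      Differentiable ℝ fun y => fderiv ℝ w y e := fun w hw =>
    ((hw.fderiv_right (m := (⊤ : ℕ∞)) (by simp)).clm_apply contDiff_const).differentiable
      (by simp)
  have hc : ∀ w : Plane → ℂ, Differentiable ℝ w → HasFDerivAt (fun y => conj (w y))
      ((Complex.conjCLE : ℂ →L[ℝ] ℂ).comp (fderiv ℝ w x)) x := fun w hw =>
    (Complex.conjCLE : ℂ →L[ℝ] ℂ).hasFDerivAt.comp x (hw x).hasFDerivAt
  have hud := hu.differentiable (by simp)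
  have hvd := hv.differentiable (by simp)
  have h := ((hd u hu x).hasFDerivAt.fun_mul (hc v hvd)).fun_sub
    ((hud x).hasFDerivAt.fun_mul (hc _ (hd v hv)))
  rw [h.fderiv]
  simp
  ring

/-- **Second Green identity for the Laplacian on the unit disk.** -/
theorem green_identity_disk (u v : Plane → ℂ)
    (hu : ContDiff ℝ (⊤ : ℕ∞) u) (hv : ContDiff ℝ (⊤ : ℕ∞) v) :
    (∫ x in Metric.ball (0 : Plane) 1,
        (lap u x * conj (v x) - u x * conj (lap v x))) =
    ∫ φ in (0:ℝ)..(2 * π),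
        (-(nder u φ) * conj (v (gam φ)) + u (gam φ) * conj (nder v φ)) := by
  have hC : ∀ e : Plane, ContDiff ℝ 1
      fun y => fderiv ℝ u y e * conj (v y) - u y * conj (fderiv ℝ v y e) := by
    intro e
    have hd : ∀ w : Plane → ℂ, ContDiff ℝ (⊤ : ℕ∞) w →
        ContDiff ℝ 1 fun y => fderiv ℝ w y e := fun w hw =>
      (hw.fderiv_right (m := (⊤ : ℕ∞)) (by simp)).clm_apply contDiff_const |>.of_le (by exact_mod_cast le_top)
    have hu1 : ContDiff ℝ 1 u := hu.of_le (by exact_mod_cast le_top)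
    have hv1 : ContDiff ℝ 1 v := hv.of_le (by exact_mod_cast le_top)
    exact ((hd u hu).mul (Complex.conjCLE.contDiff.comp hv1)).sub
      (hu1.mul (Complex.conjCLE.contDiff.comp (hd v hv)))
  have hper : Function.Periodic (fun φ =>
      -(nder u φ) * conj (v (gam φ)) + u (gam φ) * conj (nder v φ)) (2 * π) := fun φ => by
    simp only [nder, gam_periodic φ]
  have hshift := hper.intervalIntegral_add_eq 0 (-π)
  rw [zero_add, show -π + 2 * π = π by ring] at hshift
  rw [hshift]
  have key := integral_ball_divergence _ _ (hC (EuclideanSpace.single 0 1))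
    (hC (EuclideanSpace.single 1 1))
  simp_rw [fderiv_green_component u v hu hv] at key
  convert key using 1
  · congr 1
    ext x
    simp only [lap, Fin.sum_univ_two, map_add]
    ring
  · congr 1
    ext φ
    rw [nder_eq u (hu.differentiable (by simp)), nder_eq v (hv.differentiable (by simp))]
    simp only [Complex.real_smul, map_neg, map_add, map_mul, Complex.conj_ofReal]
    ring
end
end

section
/- (The kernel of the problem Δu = 0 in the unit disk, ∂ν²u = 0 on the unit circle, is spanned by 1, z, z̄.) Let u : ℝ² → ℂ be infinitely differentiable, harmonic on the open unit ball B (i.e., Δu(x) = 0 for all x ∈ B), and satisfy ∂ν²u(γ(φ)) = 0 for all φ ∈ ℝ. Then there exist complex numbers a, b, c such that u(x₁,x₂) = a + b·(x₁ + i·x₂) + c·(x₁ − i·x₂) for all (x₁,x₂) in the closed unit ball. In particular, the space of such solutions restricted to the closed unit disk has complex dimension 3. -/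
noncomputable section

open Real MeasureTheory ComplexConjugate

/-- The second inward normal derivative `∂ν² f(γ(φ)) = (d²/dr²) f(r·γ(φ)) |_{r=1}`. -/
def nder2 (f : Plane → ℂ) (φ : ℝ) : ℂ :=
  deriv (deriv (fun r : ℝ => f (r • gam φ))) 1

open InnerProductSpace Metric Set

/-- Second derivative along a line through the origin. -/
lemma deriv_deriv_comp_smul {E F : Type*} [NormedAddCommGroup E] [NormedSpace ℝ E]
    [NormedAddCommGroup F] [NormedSpace ℝ F] {f : E → F} (hf : ContDiff ℝ 2 f) (z : E) :
    (∀ r : ℝ, HasDerivAt (fun r : ℝ => f (r • z)) (fderiv ℝ f (r • z) z) r) ∧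
    (∀ r : ℝ, HasDerivAt (fun r : ℝ => fderiv ℝ f (r • z) z)
      (fderiv ℝ (fderiv ℝ f) (r • z) z z) r) := by
  have hline (r : ℝ) : HasDerivAt (fun r : ℝ => r • z) z r := by
    simpa using (hasDerivAt_id r).smul_const z
  have hf' : Differentiable ℝ (fderiv ℝ f) :=
    (hf.fderiv_right (m := 1) (by norm_num)).differentiable (by norm_num)
  refine ⟨fun r => ?_, fun r => ?_⟩
  · exact ((hf.differentiable (by norm_num)) (r • z)).hasFDerivAt.comp_hasDerivAt r (hline r)
  · have h := (hf' (r • z)).hasFDerivAt.comp_hasDerivAt r (hline r)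
    exact ((ContinuousLinearMap.apply ℝ F z).hasFDerivAt.comp_hasDerivAt r h)

/-- The radial second derivative of a harmonic function on a ball is harmonic. -/
lemma harmonicOnNhd_radial_second_deriv {f : ℂ → ℝ} {R : ℝ}
    (hf : HarmonicOnNhd f (ball 0 R)) :
    HarmonicOnNhd (fun z => fderiv ℝ (fderiv ℝ f) z z z) (ball 0 R) := by
  obtain ⟨F, hF, hFf⟩ := hf.exists_analyticOnNhd_ball_re_eq
  have h1 : ∀ z ∈ ball (0 : ℂ) R, fderiv ℝ f z =
      Complex.reCLM.comp (ContinuousLinearMap.mul ℝ ℂ (deriv F z)) := by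
    intro z hz
    have e : f =ᶠ[nhds z] Complex.reCLM ∘ F := by
      filter_upwards [isOpen_ball.mem_nhds hz] with w hw
      exact (hFf hw).symm
    rw [e.fderiv_eq]
    have := (hF z hz).differentiableAt.hasDerivAt.hasFDerivAt.restrictScalars ℝ
    rw [(Complex.reCLM.hasFDerivAt.comp z this).fderiv]
    ext; simp [mul_comm]
  have h2 : ∀ z ∈ ball (0 : ℂ) R, fderiv ℝ (fderiv ℝ f) z z z =
      (deriv (deriv F) z * z * z).re := by
    intro z hz
    let T : ℂ →L[ℝ] (ℂ →L[ℝ] ℝ) :=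
      ((ContinuousLinearMap.compL ℝ ℂ ℂ ℝ) Complex.reCLM).comp (ContinuousLinearMap.mul ℝ ℂ)
    have e : fderiv ℝ f =ᶠ[nhds z] T ∘ deriv F := by
      filter_upwards [isOpen_ball.mem_nhds hz] with w hw
      exact h1 w hw
    rw [e.fderiv_eq]
    have := (hF z hz).deriv.differentiableAt.hasDerivAt.hasFDerivAt.restrictScalars ℝ
    rw [(T.hasFDerivAt.comp z this).fderiv]
    simp [T, mul_comm]
  intro z hz
  have han : AnalyticAt ℂ (fun z => deriv (deriv F) z * z * z) z :=
    (((hF z hz).deriv.deriv).mul analyticAt_id).mul analyticAt_id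
  refine (harmonicAt_congr_nhds ?_).2 han.harmonicAt_re
  filter_upwards [isOpen_ball.mem_nhds hz] with w hw
  exact h2 w hw

/-- A harmonic function on a disk, continuous up to the boundary and vanishing there, is zero. -/
lemma eqOn_zero_of_harmonicContOnCl {f : ℂ → ℝ} {c : ℂ} {R : ℝ}
    (hf : HarmonicContOnCl f (ball c R)) (h0 : ∀ z ∈ sphere c R, f z = 0) :
    ∀ z ∈ closedBall c R, f z = 0 := by
  intro z hz
  rcases (mem_closedBall.1 hz).eq_or_lt with h | h
  · exact h0 z h
  · have hR : 0 < R := pos_of_mem_ball h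
    rw [← hf.circleAverage_poissonKernel_smul (mem_ball.2 h),
      Real.circleAverage_congr_sphere (f₂ := fun _ => (0 : ℝ))]
    · simp [Real.circleAverage_const]
    · intro w hw
      rw [abs_of_pos hR] at hw
      simp [h0 w hw]

/-- A `C²` function whose second derivative vanishes along the ray to each point of the closed unit
ball is affine there. -/
lemma eq_affine_of_radial_second_deriv_eq_zero {f : ℂ → ℝ} (hf : ContDiff ℝ 2 f)
    (h0 : ∀ z ∈ closedBall (0 : ℂ) 1, fderiv ℝ (fderiv ℝ f) z z z = 0)
    {z : ℂ} (hz : z ∈ closedBall (0 : ℂ) 1) : f z = f 0 + fderiv ℝ f 0 z := by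
  obtain ⟨hd, hdd⟩ := deriv_deriv_comp_smul hf z
  have hf2 : Continuous (fderiv ℝ (fderiv ℝ f)) :=
    (hf.fderiv_right (m := 1) (by norm_num)).continuous_fderiv (by norm_num)
  have hpos : EqOn (fun r : ℝ => fderiv ℝ (fderiv ℝ f) (r • z) z z) (fun _ => 0) (Ioo 0 1) := by
    intro r hr
    have hm : r • z ∈ closedBall (0 : ℂ) 1 := by
      simp only [mem_closedBall_zero_iff, norm_smul, Real.norm_eq_abs, abs_of_pos hr.1] at hz ⊢
      nlinarith [hr.1, hr.2, norm_nonneg z]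
    have := h0 _ hm
    simpa only [map_smul, smul_apply, smul_eq_mul, mul_eq_zero, hr.1.ne', false_or] using this
  have hI : EqOn (fun r : ℝ => fderiv ℝ (fderiv ℝ f) (r • z) z z) (fun _ => 0) (Icc 0 1) := by
    have := hpos.closure (by fun_prop) (by fun_prop)
    rwa [closure_Ioo (by norm_num)] at this
  have hc1 : ∀ r ∈ Icc (0 : ℝ) 1, fderiv ℝ f (r • z) z = fderiv ℝ f ((0 : ℝ) • z) z :=
    constant_of_has_deriv_right_zero (fun r _ => (hdd r).continuousAt.continuousWithinAt)
      (fun r hr => by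
        have := (hdd r).hasDerivWithinAt (s := Ici r)
        rwa [show fderiv ℝ (fderiv ℝ f) (r • z) z z = 0 from hI (Ico_subset_Icc_self hr)] at this)
  have hg (r : ℝ) : HasDerivAt (fun r : ℝ => f (r • z) - r * fderiv ℝ f 0 z)
      (fderiv ℝ f (r • z) z - fderiv ℝ f 0 z) r := by
    simpa only [one_mul, id] using (hd r).fun_sub ((hasDerivAt_id r).mul_const (fderiv ℝ f 0 z))
  have hc2 := constant_of_has_deriv_right_zero (a := 0) (b := 1)
      (fun r _ => (hg r).continuousAt.continuousWithinAt)
      (fun r hr => by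
        have := (hg r).hasDerivWithinAt (s := Ici r)
        rwa [hc1 r (Ico_subset_Icc_self hr), zero_smul, sub_self] at this) 1 (by simp)
  simp at hc2
  linarith

lemma eq_affine_of_harmonic {v : ℂ → ℂ} (hv : ContDiff ℝ 2 v)
    (hharm : HarmonicOnNhd v (ball 0 1))
    (hbc : ∀ z ∈ sphere (0 : ℂ) 1, fderiv ℝ (fderiv ℝ v) z z z = 0)
    {z : ℂ} (hz : z ∈ closedBall (0 : ℂ) 1) : v z = v 0 + fderiv ℝ v 0 z := by
  have hv1 : Differentiable ℝ v := hv.differentiable (by norm_num)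
  have hv2 : Differentiable ℝ (fderiv ℝ v) :=
    (hv.fderiv_right (m := 1) (by norm_num)).differentiable (by norm_num)
  have key (l : ℂ →L[ℝ] ℝ) : l (v z) = l (v 0 + fderiv ℝ v 0 z) := by
    have hf : ContDiff ℝ 2 (l ∘ v) := l.contDiff.comp hv
    have h1 : fderiv ℝ (l ∘ v) = fun w => ContinuousLinearMap.compL ℝ ℂ ℂ ℝ l (fderiv ℝ v w) := by
      ext1 w
      exact (l.hasFDerivAt.comp w (hv1 w).hasFDerivAt).fderiv
    have h2 (w : ℂ) : fderiv ℝ (fderiv ℝ (l ∘ v)) w w w = l (fderiv ℝ (fderiv ℝ v) w w w) := by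
      have h := (ContinuousLinearMap.compL ℝ ℂ ℂ ℝ l).hasFDerivAt.comp w (hv2 w).hasFDerivAt
      rw [h1]
      exact congrArg (fun T => T w w) h.fderiv
    have hcont : Continuous fun w : ℂ => fderiv ℝ (fderiv ℝ (l ∘ v)) w w w := by
      have : Continuous (fderiv ℝ (fderiv ℝ (l ∘ v))) :=
        (hf.fderiv_right (m := 1) (by norm_num)).continuous_fderiv (by norm_num)
      fun_prop
    have := eq_affine_of_radial_second_deriv_eq_zero hf
      (eqOn_zero_of_harmonicContOnCl
        ⟨harmonicOnNhd_radial_second_deriv (hharm.comp_CLM l), hcont.continuousOn⟩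
        fun w hw => by rw [h2, hbc w hw, map_zero]) hz
    rw [h1] at this
    simpa using this
  exact Complex.ext (key Complex.reCLM) (key Complex.imCLM)

/-- The isometry `x + i y ↦ (x, y)`. -/
def complexToPlane : ℂ ≃ₗᵢ[ℝ] Plane := Complex.orthonormalBasisOneI.repr

lemma complexToPlane_one : complexToPlane 1 = EuclideanSpace.single 0 1 := by
  ext i; fin_cases i <;> simp [complexToPlane]

lemma complexToPlane_I : complexToPlane Complex.I = EuclideanSpace.single 1 1 := by
  ext i; fin_cases i <;> simp [complexToPlane]

lemma complexToPlane_symm_apply (x : Plane) :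
    complexToPlane.symm x = (x 0 : ℂ) + (x 1 : ℂ) * Complex.I := by
  simp [complexToPlane]

lemma laplacian_comp_complexToPlane {u : Plane → ℂ} (hu : ContDiff ℝ 2 u) (z : ℂ) :
    Laplacian.laplacian (u ∘ complexToPlane) z = lap u (complexToPlane z) := by
  have hu2 : Differentiable ℝ (fderiv ℝ u) :=
    (hu.fderiv_right (m := 1) (by norm_num)).differentiable (by norm_num)
  have hcomp := (complexToPlane.toContinuousLinearEquiv : ℂ →L[ℝ] Plane).iteratedFDeriv_comp_right
    hu z (i := 2) le_rfl
  have hw (w : ℂ) : iteratedFDeriv ℝ 2 (u ∘ complexToPlane) z ![w, w] =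
      fderiv ℝ (fun y => fderiv ℝ u y (complexToPlane w)) (complexToPlane z)
        (complexToPlane w) := by
    have h := congrArg (fun m => m ![w, w]) hcomp
    rw [fderiv_clm_apply (hu2 _) (by fun_prop)]
    refine h.trans ?_
    simp [iteratedFDeriv_two_apply]
  rw [laplacian_eq_iteratedFDeriv_complexPlane]
  simp only [hw, lap, Fin.sum_univ_two, complexToPlane_one, complexToPlane_I]

/-- The kernel of the problem `Δu = 0` in the unit disk, `∂ν²u = 0` on the unit circle,
is spanned by `1`, `z`, `z̄`: any smooth solution coincides on the closed unit disk with
`a + b (x₁ + i x₂) + c (x₁ − i x₂)` for some complex `a, b, c`. -/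
theorem kernel_spanned_by_one_z_zbar (u : Plane → ℂ) (hu : ContDiff ℝ (⊤ : ℕ∞) u)
    (hharm : ∀ x ∈ Metric.ball (0 : Plane) 1, lap u x = 0)
    (hbc : ∀ φ : ℝ, nder2 u φ = 0) :
    ∃ a b c : ℂ, ∀ x ∈ Metric.closedBall (0 : Plane) 1,
      u x = a + b * ((x 0 : ℂ) + Complex.I * (x 1 : ℂ))
              + c * ((x 0 : ℂ) - Complex.I * (x 1 : ℂ)) := by
  have hu2 : ContDiff ℝ 2 u := hu.of_le (WithTop.coe_le_coe.2 le_top)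
  set v : ℂ → ℂ := u ∘ complexToPlane with hv_def
  have hv : ContDiff ℝ 2 v := hu2.comp complexToPlane.contDiff
  have hvharm : HarmonicOnNhd v (ball 0 1) := by
    intro z hz
    refine ⟨hv.contDiffAt, ?_⟩
    filter_upwards [isOpen_ball.mem_nhds hz] with w hw
    rw [hv_def, laplacian_comp_complexToPlane hu2]
    exact hharm _ (by simpa using hw)
  have hvbc : ∀ z ∈ sphere (0 : ℂ) 1, fderiv ℝ (fderiv ℝ v) z z z = 0 := by
    intro z hz
    obtain ⟨hd, hdd⟩ := deriv_deriv_comp_smul hv z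
    have hgam : gam z.arg = complexToPlane z := by
      have hz1 : ‖z‖ = 1 := by simpa using hz
      have hz0 : z ≠ 0 := by rintro rfl; simp at hz1
      ext i
      fin_cases i <;> simp [gam, complexToPlane, Complex.cos_arg hz0, Complex.sin_arg, hz1]
    have h := hbc z.arg
    have hfun : (fun r : ℝ => u (r • gam z.arg)) = fun r : ℝ => v (r • z) := by
      funext r
      rw [hgam, hv_def, Function.comp_apply, map_smul]
    rw [nder2, hfun, funext fun r => (hd r).deriv, (hdd 1).deriv, one_smul] at h
    exact h
  set L := fderiv ℝ v 0
  refine ⟨v 0, (L 1 - Complex.I * L Complex.I) / 2, (L 1 + Complex.I * L Complex.I) / 2,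
    fun x hx => ?_⟩
  have h := eq_affine_of_harmonic hv hvharm hvbc (z := complexToPlane.symm x) (by simpa using hx)
  have hL : L (complexToPlane.symm x) = x 0 * L 1 + x 1 * L Complex.I := by
    have : complexToPlane.symm x = x 0 • (1 : ℂ) + x 1 • Complex.I := by
      simp [complexToPlane_symm_apply]
    rw [this, map_add, map_smul, map_smul]
    simp
  change v (complexToPlane.symm x) = v 0 + L (complexToPlane.symm x) at h
  rw [hL] at h
  simp only [hv_def, Function.comp_apply, LinearIsometryEquiv.apply_symm_apply] at h ⊢
  rw [h]
  linear_combination (x 1 : ℂ) * L Complex.I * Complex.I_sq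
end
end
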